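/- Every canonical answer set of a dl-program K = (O,P) is noncircular: there is no nonempty M ⊆ I such that for every rule h ← Pos, not Neg in P with h ∈ M whose body is satisfied by I relative to O, the body is not satisfied by I \ M relative to O. -/

import Mathlib

namespace DLP

/-- The three dl-atom input operators ⊕, ⊙, ⊖. -/
inductive Op | oplus | odot | ominus

/-- An abstract dl-atom `DL[S₁ op₁ p₁, …; Q](t)`: a list of inputs together with
the entailment check `O ∪ A ⊨ Q(t)` applied to a set of (possibly negated) assertions. -/
structure DLA (Conc Pred Arg : Type) where
  inputs : List (Conc × Op × Pred)
  entails : Set (Conc × Arg × Bool) → Prop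

variable {Conc Pred Arg : Type}

/-- Atoms of the Herbrand base: predicate applied to an argument tuple. -/
abbrev Atom (Pred Arg : Type) := Pred × Arg

/-- Interpretations are subsets of the Herbrand base. -/
abbrev Interp (Pred Arg : Type) := Set (Atom Pred Arg)

/-- Extension of a predicate under an interpretation. -/
def extOf (I : Interp Pred Arg) : Pred → Set Arg := fun p => {e | (p, e) ∈ I}

/-- The assertions contributed by one input entry, given predicate extensions. -/
def contrib (ext : Pred → Set Arg) : Conc × Op × Pred → Set (Conc × Arg × Bool)
  | (S, Op.oplus, p) => {x | ∃ e ∈ ext p, x = (S, e, true)}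
  | (S, Op.odot, p) => {x | ∃ e ∈ ext p, x = (S, e, false)}
  | (S, Op.ominus, p) => {x | ∃ e, e ∉ ext p ∧ x = (S, e, false)}

/-- Evaluate a dl-atom on given predicate extensions. -/
def DLA.eval (A : DLA Conc Pred Arg) (ext : Pred → Set Arg) : Prop :=
  A.entails {x | ∃ c ∈ A.inputs, x ∈ contrib ext c}

/-- `I ⊨_O A` for a dl-atom `A`. -/
def DLA.sat (A : DLA Conc Pred Arg) (I : Interp Pred Arg) : Prop := A.eval (extOf I)

/-- A dl-atom is monotonic (relative to the program) if `I ⊨_O A` and `I ⊆ I'` imply `I' ⊨_O A`. -/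
def DLA.Mono (A : DLA Conc Pred Arg) : Prop :=
  ∀ ⦃I J : Interp Pred Arg⦄, I ⊆ J → A.sat I → A.sat J

/-- A body element: an ordinary atom or a dl-atom. -/
abbrev BodyElem (Conc Pred Arg : Type) := Atom Pred Arg ⊕ DLA Conc Pred Arg

/-- Satisfaction of a body element: membership for atoms, dl-satisfaction for dl-atoms. -/
def satB (I : Interp Pred Arg) : BodyElem Conc Pred Arg → Prop
  | Sum.inl a => a ∈ I
  | Sum.inr d => d.sat I

/-- A dl-rule `head ← Pos, not Neg`. -/
structure Rule (Conc Pred Arg : Type) where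
  head : Atom Pred Arg
  pos : Set (BodyElem Conc Pred Arg)
  neg : Set (BodyElem Conc Pred Arg)

/-- A dl-program: a set of dl-rules (the ontology `O` is folded into the
entailment relation carried by each dl-atom). -/
structure Prog (Conc Pred Arg : Type) where
  rules : Set (Rule Conc Pred Arg)

/-- `I` satisfies the body of rule `r` relative to `O`. -/
def satBody (I : Interp Pred Arg) (r : Rule Conc Pred Arg) : Prop :=
  (∀ b ∈ r.pos, satB I b) ∧ (∀ b ∈ r.neg, ¬ satB I b)

/-- `I` is a model of the dl-program. -/
def isModel (P : Prog Conc Pred Arg) (I : Interp Pred Arg) : Prop :=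
  ∀ r ∈ P.rules, satBody I r → r.head ∈ I

/-- `I` is a supported model of the dl-program. -/
def Supported (P : Prog Conc Pred Arg) (I : Interp Pred Arg) : Prop :=
  isModel P I ∧ ∀ h ∈ I, ∃ r ∈ P.rules, r.head = h ∧ satBody I r

/-- `I` satisfies the completion `COMP(K)` relative to `O`. -/
def satComp (P : Prog Conc Pred Arg) (I : Interp Pred Arg) : Prop :=
  ∀ h : Atom Pred Arg, h ∈ I ↔ ∃ r ∈ P.rules, r.head = h ∧ satBody I r

/-- A positive dl-program: no negation as failure, and all occurring dl-atoms monotonic. -/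
def Positive (P : Prog Conc Pred Arg) : Prop :=
  (∀ r ∈ P.rules, r.neg = (∅ : Set (BodyElem Conc Pred Arg))) ∧
  (∀ r ∈ P.rules, ∀ d : DLA Conc Pred Arg, Sum.inr d ∈ r.pos ∪ r.neg → d.Mono)

/-- One-step consequence operator `γ_K`. -/
def gamma (P : Prog Conc Pred Arg) (J : Interp Pred Arg) : Interp Pred Arg :=
  {h | ∃ r ∈ P.rules, r.head = h ∧ ∀ b ∈ r.pos, satB J b}

/-- Least fixed point of the one-step consequence operator (Knaster–Tarski form). -/
def lfpGamma (P : Prog Conc Pred Arg) : Interp Pred Arg :=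
  ⋂₀ {J | gamma P J ⊆ J}

/-- The weak dl-transform `wP_O^I`. -/
def weakReduct (P : Prog Conc Pred Arg) (I : Interp Pred Arg) : Prog Conc Pred Arg :=
  ⟨{r' | ∃ r ∈ P.rules,
      (∀ d : DLA Conc Pred Arg, Sum.inr d ∈ r.pos → d.sat I) ∧
      (∀ b ∈ r.neg, ¬ satB I b) ∧
      r' = ⟨r.head, {b ∈ r.pos | ∃ a, b = Sum.inl a}, ∅⟩}⟩

/-- The strong dl-transform `sP_O^I`. -/
def strongReduct (P : Prog Conc Pred Arg) (I : Interp Pred Arg) : Prog Conc Pred Arg :=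
  ⟨{r' | ∃ r ∈ P.rules,
      (∀ d : DLA Conc Pred Arg, Sum.inr d ∈ r.pos → ¬ d.Mono → d.sat I) ∧
      (∀ b ∈ r.neg, ¬ satB I b) ∧
      r' = ⟨r.head,
            {b ∈ r.pos | (∃ a, b = Sum.inl a) ∨ ∃ d : DLA Conc Pred Arg, b = Sum.inr d ∧ d.Mono},
            ∅⟩}⟩

/-- `I` is a weak answer set: the least model of the weak dl-transform. -/
def WeakAS (P : Prog Conc Pred Arg) (I : Interp Pred Arg) : Prop :=
  IsLeast {J | isModel (weakReduct P I) J} I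

/-- `I` is a strong answer set: the least model of the strong dl-transform. -/
def StrongAS (P : Prog Conc Pred Arg) (I : Interp Pred Arg) : Prop :=
  IsLeast {J | isModel (strongReduct P I) J} I

/-- A loop of a directed graph: a nonempty vertex set through which a cycle passes,
visiting only and all its nodes (i.e., strongly connected via nonempty paths inside `L`). -/
def IsLoop {α : Type} (E : α → α → Prop) (L : Set α) : Prop :=
  L.Nonempty ∧ ∀ u ∈ L, ∀ v ∈ L,
    Relation.TransGen (fun a b => E a b ∧ a ∈ L ∧ b ∈ L) u v

/-- A maximal loop. -/
def MaxLoop {α : Type} (E : α → α → Prop) (L : Set α) : Prop :=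
  IsLoop E L ∧ ∀ L', IsLoop E L' → L ⊆ L' → L' = L

/-- A terminating loop: a maximal loop from which no other maximal loop is reachable. -/
def TermLoop {α : Type} (E : α → α → Prop) (L : Set α) : Prop :=
  MaxLoop E L ∧ ∀ L', MaxLoop E L' → L' ≠ L →
    ∀ u ∈ L, ∀ v ∈ L', ¬ Relation.ReflTransGen E u v

/-- Edge relation of the weak positive dependency graph. -/
def edgeWeak (P : Prog Conc Pred Arg) (u v : Atom Pred Arg) : Prop :=
  ∃ r ∈ P.rules, r.head = u ∧ Sum.inl v ∈ r.pos

/-- The dl-atom mentions predicate `q` among its input predicates. -/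
def mentionsPred (d : DLA Conc Pred Arg) (q : Pred) : Prop :=
  ∃ S op, (S, op, q) ∈ d.inputs

/-- Edge relation of the strong positive dependency graph. -/
def edgeStrong (P : Prog Conc Pred Arg) (u v : Atom Pred Arg) : Prop :=
  ∃ r ∈ P.rules, r.head = u ∧
    (Sum.inl v ∈ r.pos ∨
     ∃ d : DLA Conc Pred Arg, Sum.inr d ∈ r.pos ∧ d.Mono ∧ mentionsPred d v.1)

/-- Satisfaction of the weak loop formula `wLF(L,K)` by `I` relative to `O`. -/
def satWLF (P : Prog Conc Pred Arg) (I : Interp Pred Arg) (L : Set (Atom Pred Arg)) : Prop :=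
  (∃ a ∈ L, a ∈ I) →
    ∃ r ∈ P.rules, r.head ∈ L ∧ (∀ a ∈ L, Sum.inl a ∉ r.pos) ∧ satBody I r

/-- Predicate extensions used by the irrelevant formula `IF(A,L)`: predicates occurring
in `L` are renamed to `p_L`, whose extension (under the extension `I'` of `I`) consists of
the `p`-atoms of `I \ L`; other predicates keep their extension in `I`. -/
def extIF (I L : Interp Pred Arg) : Pred → Set Arg := fun p =>
  {e | ((∃ e', (p, e') ∈ L) ∧ (p, e) ∈ I \ L) ∨ ((¬ ∃ e', (p, e') ∈ L) ∧ (p, e) ∈ I)}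

/-- `I' ⊨_O IF(A,L)`: the irrelevant formula of `A` relative to `L`, evaluated under
the extension `I'` of `I` satisfying the renamed-predicate axioms. -/
def satIF (A : DLA Conc Pred Arg) (I L : Interp Pred Arg) : Prop :=
  A.eval (extIF I L)

/-- Satisfaction of `γ(A, L)`-transformed positive body elements
(monotonic dl-atoms are replaced by their irrelevant formulas). -/
def satGammaB (I L : Interp Pred Arg) : BodyElem Conc Pred Arg → Prop
  | Sum.inl a => a ∈ I
  | Sum.inr d => (d.Mono → satIF d I L) ∧ (¬ d.Mono → d.sat I)

/-- Satisfaction of the strong loop formula `sLF(L,K)` by (the extension of) `I`. -/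
def satSLF (P : Prog Conc Pred Arg) (I : Interp Pred Arg) (L : Set (Atom Pred Arg)) : Prop :=
  (∃ a ∈ L, a ∈ I) →
    ∃ r ∈ P.rules, r.head ∈ L ∧ (∀ a ∈ L, Sum.inl a ∉ r.pos) ∧
      (∀ b ∈ r.pos, satGammaB I L b) ∧ (∀ b ∈ r.neg, ¬ satB I b)

/-- `v` is a positive (nonmonotonic) dependency of dl-atom `d`. -/
def posDep (d : DLA Conc Pred Arg) (v : Atom Pred Arg) : Prop :=
  ∃ I : Interp Pred Arg, ¬ d.sat I ∧ d.sat (I ∪ {v})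

/-- `v` is a negative (nonmonotonic) dependency of dl-atom `d`. -/
def negDep (d : DLA Conc Pred Arg) (v : Atom Pred Arg) : Prop :=
  ∃ I : Interp Pred Arg, d.sat I ∧ ¬ d.sat (I ∪ {v})

/-- Edge relation of the canonical dependency graph. -/
def edgeCanon (P : Prog Conc Pred Arg) (u v : Atom Pred Arg) : Prop :=
  ∃ r ∈ P.rules, r.head = u ∧
    ((∃ b ∈ r.pos, ∃ I : Interp Pred Arg, ¬ satB I b ∧ satB (I ∪ {v}) b) ∨
     (∃ b ∈ r.neg, ∃ I : Interp Pred Arg, satB I b ∧ ¬ satB (I ∪ {v}) b))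

/-- Predicate extensions for the positive canonical irrelevant formula `pCF(A,L)`:
only predicates having an atom in `L` that is a positive dependency of `A` are renamed. -/
def extPCF (d : DLA Conc Pred Arg) (I L : Interp Pred Arg) : Pred → Set Arg := fun p =>
  {e | ((∃ e', (p, e') ∈ L ∧ posDep d (p, e')) ∧ (p, e) ∈ I \ L) ∨
       ((¬ ∃ e', (p, e') ∈ L ∧ posDep d (p, e')) ∧ (p, e) ∈ I)}

/-- Predicate extensions for the negative canonical irrelevant formula `nCF(A,L)`. -/
def extNCF (d : DLA Conc Pred Arg) (I L : Interp Pred Arg) : Pred → Set Arg := fun p =>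
  {e | ((∃ e', (p, e') ∈ L ∧ negDep d (p, e')) ∧ (p, e) ∈ I \ L) ∨
       ((¬ ∃ e', (p, e') ∈ L ∧ negDep d (p, e')) ∧ (p, e) ∈ I)}

/-- `I' ⊨_O pCF(A,L)`. -/
def satPCF (d : DLA Conc Pred Arg) (I L : Interp Pred Arg) : Prop := d.eval (extPCF d I L)

/-- `I' ⊨_O nCF(A,L)`. -/
def satNCF (d : DLA Conc Pred Arg) (I L : Interp Pred Arg) : Prop := d.eval (extNCF d I L)

/-- `δ₁(A,L)`: nonmonotonic dl-atoms are replaced by `pCF(A,L)`; otherwise `γ(A,L)`. -/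
def satDelta1 (I L : Interp Pred Arg) : BodyElem Conc Pred Arg → Prop
  | Sum.inl a => a ∈ I
  | Sum.inr d => (¬ d.Mono → satPCF d I L) ∧ (d.Mono → satIF d I L)

/-- `δ₂(B,L)`: nonmonotonic dl-atoms are replaced by `nCF(B,L)`; otherwise unchanged. -/
def satDelta2 (I L : Interp Pred Arg) : BodyElem Conc Pred Arg → Prop
  | Sum.inl a => a ∈ I
  | Sum.inr d => (¬ d.Mono → satNCF d I L) ∧ (d.Mono → d.sat I)

/-- Satisfaction of the canonical loop formula `cLF(L,M,K)` by (the extension of) `I`. -/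
def satCLF (P : Prog Conc Pred Arg) (I M : Interp Pred Arg) (L : Set (Atom Pred Arg)) : Prop :=
  (∃ a ∈ L, a ∈ I) →
    ∃ r ∈ P.rules, r.head ∈ L ∧ (∀ a ∈ L, Sum.inl a ∉ r.pos) ∧ satBody M r ∧
      (∀ b ∈ r.pos, satDelta1 I L b) ∧ (∀ b ∈ r.neg, ¬ satDelta2 I L b)

/-- `I` is a canonical answer set of the dl-program. -/
def CanonAS (P : Prog Conc Pred Arg) (I : Interp Pred Arg) : Prop :=
  satComp P I ∧ ∀ L, IsLoop (edgeCanon P) L → satCLF P I I L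

/-- A normal logic program: all body elements are ordinary atoms. -/
def Normal (P : Prog Conc Pred Arg) : Prop :=
  ∀ r ∈ P.rules, ∀ b ∈ r.pos ∪ r.neg, ∃ a : Atom Pred Arg, b = Sum.inl a

/-- The Gelfond–Lifschitz-style reduct: delete rules with a satisfied negated body
member, and delete all negated members from remaining rules. -/
def glReduct (P : Prog Conc Pred Arg) (I : Interp Pred Arg) : Prog Conc Pred Arg :=
  ⟨{r' | ∃ r ∈ P.rules, (∀ b ∈ r.neg, ¬ satB I b) ∧ r' = ⟨r.head, r.pos, ∅⟩}⟩


/-- If `Q` flips from false to true between `A ⊆ B`, some element of `B \ A` makes it flip. -/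
lemma exists_flip {α : Type} [Finite α] (Q : Set α → Prop) {A B : Set α} (hAB : A ⊆ B)
    (hA : ¬ Q A) (hB : Q B) : ∃ v ∈ B, v ∉ A ∧ ∃ S, ¬ Q S ∧ Q (S ∪ {v}) := by
  by_contra hcon
  have key : ∀ T : Set α, T ⊆ B \ A → ¬ Q (A ∪ T) := by
    intro T hT
    induction T, Set.toFinite T using Set.Finite.induction_on with
    | empty => simpa using hA
    | @insert a T _ _ ih =>
      intro hQ
      apply hcon
      have ha := hT (Set.mem_insert a T)
      refine ⟨a, ha.1, ha.2, A ∪ T, ih (fun x hx => hT (Set.mem_insert_of_mem a hx)), ?_⟩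
      have : A ∪ T ∪ {a} = A ∪ insert a T := by
        rw [Set.union_assoc, Set.union_singleton]
      rwa [this]
  apply key (B \ A) le_rfl
  rwa [Set.union_diff_cancel hAB]

/-- If every vertex of a finite nonempty `M` has a successor in `M`, there is a loop in `M`
closed under successors in `M`. -/
lemma exists_terminal_loop {α : Type} [Finite α] (E : α → α → Prop) {M : Set α}
    (hM : M.Nonempty) (hout : ∀ u ∈ M, ∃ v ∈ M, E u v) :
    ∃ L ⊆ M, IsLoop E L ∧ ∀ u ∈ L, ∀ v ∈ M, E u v → v ∈ L := by
  let C : Set (Set α) := {L | L ⊆ M ∧ L.Nonempty ∧ ∀ u ∈ L, ∀ v ∈ M, E u v → v ∈ L}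
  obtain ⟨L, hL⟩ := (Set.toFinite C).exists_minimal ⟨M, le_rfl, hM, fun _ _ v hv _ => hv⟩
  obtain ⟨⟨hLM, hne, hcl⟩, hmin⟩ := hL
  refine ⟨L, hLM, ⟨hne, fun u hu v hv => ?_⟩, hcl⟩
  let R : α → α → Prop := fun a b => E a b ∧ a ∈ L ∧ b ∈ L
  have hRL : ∀ {w}, Relation.TransGen R u w → w ∈ L := by
    intro w hw
    cases hw with
    | single h => exact h.2.2
    | tail _ h => exact h.2.2
  have hC : {w | Relation.TransGen R u w} ∈ C := by
    refine ⟨fun w hw => hLM (hRL hw), ?_, ?_⟩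
    · obtain ⟨w, hw, hE⟩ := hout u (hLM hu)
      exact ⟨w, Relation.TransGen.single ⟨hE, hu, hcl u hu w hw hE⟩⟩
    · intro w hw x hx hE
      exact Relation.TransGen.tail hw ⟨hE, hRL hw, hcl w (hRL hw) x hx hE⟩
  exact hmin hC (fun w hw => hRL hw) hv

/-- Every canonical answer set I is noncircular: there is no nonempty
M ⊆ I such that every rule with head in M whose body is satisfied by I has its body
unsatisfied by I \ M. -/
theorem stmt16 {Conc Pred Arg : Type} [Fintype Pred] [Fintype Arg]
    (K : Prog Conc Pred Arg) (I : Interp Pred Arg) (h : CanonAS K I) :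
    ¬ ∃ M : Interp Pred Arg, M.Nonempty ∧ M ⊆ I ∧
      ∀ r ∈ K.rules, r.head ∈ M → satBody I r → ¬ satBody (I \ M) r := by
  rintro ⟨M, hMne, hMI, hM⟩
  obtain ⟨hcomp, hloop⟩ := h
  have hsub : I \ M ⊆ I := Set.diff_subset
  have hout : ∀ u ∈ M, ∃ v ∈ M, edgeCanon K u v := by
    intro u hu
    obtain ⟨r, hr, rfl, hb⟩ := (hcomp u).1 (hMI hu)
    have hn := hM r hr hu hb
    by_cases hp : ∀ b ∈ r.pos, satB (I \ M) b
    · have : ∃ b ∈ r.neg, satB (I \ M) b := by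
        by_contra hc
        exact hn ⟨hp, fun b hbn hs => hc ⟨b, hbn, hs⟩⟩
      obtain ⟨b, hbn, hs⟩ := this
      obtain ⟨v, hv, hv', S, h1, h2⟩ := exists_flip (fun J => ¬ satB J b) hsub
        (not_not_intro hs) (hb.2 b hbn)
      refine ⟨v, ?_, r, hr, rfl, Or.inr ⟨b, hbn, S, not_not.1 h1, h2⟩⟩
      by_contra hvM
      exact hv' ⟨hv, hvM⟩
    · push Not at hp
      obtain ⟨b, hbp, hs⟩ := hp
      obtain ⟨v, hv, hv', S, h1, h2⟩ := exists_flip (fun J => satB J b) hsub hs (hb.1 b hbp)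
      refine ⟨v, ?_, r, hr, rfl, Or.inl ⟨b, hbp, S, h1, h2⟩⟩
      by_contra hvM
      exact hv' ⟨hv, hvM⟩
  obtain ⟨L, hLM, hL, hcl⟩ := exists_terminal_loop (edgeCanon K) hMne hout
  obtain ⟨a, ha⟩ := hL.1
  obtain ⟨r, hr, hrL, hat, hb, hd1, hd2⟩ := hloop L hL ⟨a, ha, hMI (hLM ha)⟩
  apply hM r hr (hLM hrL) hb
  constructor
  · intro b hbp
    by_contra hs
    -- no positive flip by an element of `M \ L`
    have hpos : ∀ v ∈ M, (∃ S : Interp Pred Arg, ¬ satB S b ∧ satB (S ∪ {v}) b) → v ∈ L := by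
      intro v hv hS
      exact hcl r.head hrL v hv ⟨r, hr, rfl, Or.inl ⟨b, hbp, hS⟩⟩
    have hdelta := hd1 b hbp
    cases b with
    | inl a =>
      have haI : a ∈ I := hdelta
      have haM : a ∈ M := by
        by_contra hc
        exact hs ⟨haI, hc⟩
      exact hat a (hpos a haM ⟨∅, by simp [satB], by simp [satB]⟩) hbp
    | inr d =>
      by_cases hm : d.Mono
      · have hJ : d.sat {x | x.2 ∈ extIF I L x.1} := hdelta.2 hm
        obtain ⟨v, hv, hv', S, h1, h2⟩ := exists_flip (fun J => d.sat J) (A := I \ M) (by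
          rintro ⟨p, e⟩ ⟨hI, hnM⟩
          by_cases hq : ∃ e', (p, e') ∈ L
          · exact Or.inl ⟨hq, hI, fun hc => hnM (hLM hc)⟩
          · exact Or.inr ⟨hq, hI⟩) hs hJ
        obtain ⟨p, e⟩ := v
        rcases hv with ⟨_, hI, hnL⟩ | ⟨hq, hI⟩
        · have hvM : (p, e) ∈ M := by
            by_contra hc
            exact hv' ⟨hI, hc⟩
          exact hnL (hpos _ hvM ⟨S, h1, h2⟩)
        · have hvM : (p, e) ∈ M := by
            by_contra hc
            exact hv' ⟨hI, hc⟩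
          exact hq ⟨e, hpos _ hvM ⟨S, h1, h2⟩⟩
      · have hJ : d.sat {x | x.2 ∈ extPCF d I L x.1} := hdelta.1 hm
        obtain ⟨v, hv, hv', S, h1, h2⟩ := exists_flip (fun J => d.sat J) (A := I \ M) (by
          rintro ⟨p, e⟩ ⟨hI, hnM⟩
          by_cases hq : ∃ e', (p, e') ∈ L ∧ posDep d (p, e')
          · exact Or.inl ⟨hq, hI, fun hc => hnM (hLM hc)⟩
          · exact Or.inr ⟨hq, hI⟩) hs hJ
        obtain ⟨p, e⟩ := v
        rcases hv with ⟨_, hI, hnL⟩ | ⟨hq, hI⟩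
        · have hvM : (p, e) ∈ M := by
            by_contra hc
            exact hv' ⟨hI, hc⟩
          exact hnL (hpos _ hvM ⟨S, h1, h2⟩)
        · have hvM : (p, e) ∈ M := by
            by_contra hc
            exact hv' ⟨hI, hc⟩
          exact hq ⟨e, hpos _ hvM ⟨S, h1, h2⟩, S, h1, h2⟩
  · intro b hbn hs
    have hneg : ∀ v ∈ M, (∃ S : Interp Pred Arg, satB S b ∧ ¬ satB (S ∪ {v}) b) → v ∈ L := by
      intro v hv hS
      exact hcl r.head hrL v hv ⟨r, hr, rfl, Or.inr ⟨b, hbn, hS⟩⟩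
    have hnI := hb.2 b hbn
    have hdelta := hd2 b hbn
    cases b with
    | inl a => exact hnI hs.1
    | inr d =>
      by_cases hm : d.Mono
      · exact hnI (hm hsub hs)
      · have hJ : ¬ d.sat {x | x.2 ∈ extNCF d I L x.1} := fun hc =>
          hdelta ⟨fun _ => hc, fun hm' => absurd hm' hm⟩
        obtain ⟨v, hv, hv', S, h1, h2⟩ := exists_flip (fun J => ¬ d.sat J) (A := I \ M) (by
          rintro ⟨p, e⟩ ⟨hI, hnM⟩
          by_cases hq : ∃ e', (p, e') ∈ L ∧ negDep d (p, e')
          · exact Or.inl ⟨hq, hI, fun hc => hnM (hLM hc)⟩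
          · exact Or.inr ⟨hq, hI⟩) (not_not_intro hs) hJ
        have h1 := not_not.1 h1
        obtain ⟨p, e⟩ := v
        rcases hv with ⟨_, hI, hnL⟩ | ⟨hq, hI⟩
        · have hvM : (p, e) ∈ M := by
            by_contra hc
            exact hv' ⟨hI, hc⟩
          exact hnL (hneg _ hvM ⟨S, h1, h2⟩)
        · have hvM : (p, e) ∈ M := by
            by_contra hc
            exact hv' ⟨hI, hc⟩
          exact hq ⟨e, hneg _ hvM ⟨S, h1, h2⟩, S, h1, h2⟩

end DLP
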